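/- Let u be a complex-valued Schwartz function on ℝ. Then for every x ∈ ℝ, 𝓕⁻¹(ξ ↦ (1 + 4π²ξ²)^{-2} (𝓕u)(ξ))(x) = (1/4) ∫_ℝ e^{-|x−y|} (|x−y| + 1) u(y) dy. -/

import Mathlib

open Real MeasureTheory FourierTransform

open Set in
theorem integrableOn_Ioi_add_one_mul_cexp {a : ℂ} (ha : 0 < a.re) :
    IntegrableOn (fun x : ℝ => ((x : ℂ) + 1) * Complex.exp (-a * x)) (Ioi 0) := by
  have hre : IntegrableOn (fun x : ℝ => x ^ (1 : ℝ) * Real.exp (-a.re * x)) (Ioi 0) := by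
    simpa using integrableOn_rpow_mul_exp_neg_mul_rpow (s := 1) (p := 1) (by norm_num) one_pos ha
  have hexp : IntegrableOn (fun x : ℝ => Real.exp (-a.re * x)) (Ioi 0) :=
    integrableOn_exp_mul_Ioi (by linarith) 0
  refine (hre.add hexp).mono' (by fun_prop) ?_
  filter_upwards [ae_restrict_mem measurableSet_Ioi] with x hx
  have hx' : (0 : ℝ) < x := hx
  have h1 : ‖(x : ℂ) + 1‖ = x + 1 := by
    rw [← Complex.ofReal_one, ← Complex.ofReal_add, Complex.norm_real, Real.norm_of_nonneg]
    positivity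
  rw [norm_mul, h1, Complex.norm_exp]
  simp [add_mul]

open Set Filter Topology in
theorem integral_Ioi_add_one_mul_cexp {a : ℂ} (ha : 0 < a.re) :
    ∫ x : ℝ in Ioi 0, ((x : ℂ) + 1) * Complex.exp (-a * x) = 1 / a + 1 / a ^ 2 := by
  have ha0 : a ≠ 0 := by
    rintro rfl
    simp at ha
  have hderiv (x : ℝ) : HasDerivAt
      (fun x : ℝ => -(((x : ℂ) + 1) / a + 1 / a ^ 2) * Complex.exp (-a * x))
      (((x : ℂ) + 1) * Complex.exp (-a * x)) x := by
    have hx : HasDerivAt (fun x : ℝ => (x : ℂ)) 1 x := Complex.ofRealCLM.hasDerivAt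
    convert! ((((hx.add_const 1).div_const a).add_const (1 / a ^ 2)).neg).mul
      ((hx.const_mul (-a)).cexp) using 1
    simp only [Pi.neg_apply]
    field_simp
    ring
  have hexp : Tendsto (fun x : ℝ => Complex.exp (-a * x)) atTop (𝓝 0) := by
    rw [tendsto_zero_iff_norm_tendsto_zero]
    have := tendsto_rpow_mul_exp_neg_mul_atTop_nhds_zero 0 a.re ha
    simpa [Complex.norm_exp] using this
  have hmul : Tendsto (fun x : ℝ => (x : ℂ) * Complex.exp (-a * x)) atTop (𝓝 0) := by
    rw [tendsto_zero_iff_norm_tendsto_zero]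
    have := (tendsto_rpow_mul_exp_neg_mul_atTop_nhds_zero 1 a.re ha).norm
    simpa [Complex.norm_exp] using this
  have hlim : Tendsto (fun x : ℝ => -(((x : ℂ) + 1) / a + 1 / a ^ 2) * Complex.exp (-a * x))
      atTop (𝓝 0) := by
    have := (hmul.const_mul (-(1 / a))).add (hexp.const_mul (-(1 / a + 1 / a ^ 2)))
    simp only [mul_zero, add_zero] at this
    refine this.congr fun x => ?_
    ring
  rw [integral_Ioi_of_hasDerivAt_of_tendsto' (fun x _ => hderiv x)
    (integrableOn_Ioi_add_one_mul_cexp ha) hlim]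
  simp

open Set in
theorem integrable_of_integrableOn_Ioi_of_comp_neg {E : Type*} [NormedAddCommGroup E] {f : ℝ → E}
    (hf : IntegrableOn f (Ioi 0)) (hf' : IntegrableOn (fun x => f (-x)) (Ioi 0)) :
    Integrable f := by
  have h : IntegrableOn f (Iio 0) := by
    rw [← (Measure.measurePreserving_neg (volume : Measure ℝ)).integrableOn_comp_preimage
      (Homeomorph.neg ℝ).measurableEmbedding]
    simpa [Function.comp_def] using hf'
  rw [← integrableOn_univ, ← Iic_union_Ioi (a := (0 : ℝ))]
  exact ((integrableOn_Iic_iff_integrableOn_Iio).2 h).union hf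

open Set in
theorem integral_eq_integral_Ioi_add_integral_Ioi_comp_neg {E : Type*} [NormedAddCommGroup E]
    [NormedSpace ℝ E] {f : ℝ → E} (hf : Integrable f) :
    ∫ x, f x = (∫ x in Ioi 0, f x) + ∫ x in Ioi 0, f (-x) := by
  rw [integral_comp_neg_Ioi, neg_zero, add_comm,
    intervalIntegral.integral_Iic_add_Ioi hf.integrableOn hf.integrableOn]

theorem integrable_exp_neg_abs_mul_abs_add_one :
    Integrable fun x : ℝ => ((Real.exp (-|x|) * (|x| + 1) : ℝ) : ℂ) := by
  have h : IntegrableOn (fun x : ℝ => ((Real.exp (-|x|) * (|x| + 1) : ℝ) : ℂ)) (Set.Ioi 0) := by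
    refine (integrableOn_Ioi_add_one_mul_cexp (a := 1) (by simp)).congr_fun (fun x hx => ?_)
      measurableSet_Ioi
    simp [abs_of_pos (show 0 < x from hx), mul_comm]
  exact integrable_of_integrableOn_Ioi_of_comp_neg h (by simpa only [abs_neg] using h)

theorem fourier_exp_neg_abs_mul_abs_add_one (ξ : ℝ) :
    𝓕 (fun x : ℝ => ((Real.exp (-|x|) * (|x| + 1) : ℝ) : ℂ)) ξ
      = 4 * ((((1 + 4 * π ^ 2 * ξ ^ 2) ^ 2)⁻¹ : ℝ) : ℂ) := by
  have hint := (Real.fourierIntegral_convergent_iff ξ).2 integrable_exp_neg_abs_mul_abs_add_one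
  rw [Real.fourier_eq, integral_eq_integral_Ioi_add_integral_Ioi_comp_neg hint]
  have hpos : ∫ x : ℝ in Set.Ioi 0,
      𝐞 (-inner ℝ x ξ) • ((Real.exp (-|x|) * (|x| + 1) : ℝ) : ℂ)
      = 1 / (1 + 2 * π * ξ * Complex.I) + 1 / (1 + 2 * π * ξ * Complex.I) ^ 2 := by
    rw [← integral_Ioi_add_one_mul_cexp (by simp)]
    refine setIntegral_congr_fun measurableSet_Ioi fun x hx => ?_
    simp only [abs_of_pos (show 0 < x from hx), Circle.smul_def, Real.fourierChar_apply,
      smul_eq_mul, Complex.ofReal_mul, Complex.ofReal_exp]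
    rw [← mul_assoc, ← Complex.exp_add, mul_comm]
    push_cast
    congr 2
    simp
    ring
  have hneg : ∫ x : ℝ in Set.Ioi 0,
      𝐞 (-inner ℝ (-x) ξ) • ((Real.exp (-|-x|) * (|-x| + 1) : ℝ) : ℂ)
      = 1 / (1 - 2 * π * ξ * Complex.I) + 1 / (1 - 2 * π * ξ * Complex.I) ^ 2 := by
    rw [← integral_Ioi_add_one_mul_cexp (by simp)]
    refine setIntegral_congr_fun measurableSet_Ioi fun x hx => ?_
    simp only [abs_neg, abs_of_pos (show 0 < x from hx), Circle.smul_def, Real.fourierChar_apply,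
      smul_eq_mul, Complex.ofReal_mul, Complex.ofReal_exp]
    rw [← mul_assoc, ← Complex.exp_add, mul_comm]
    push_cast
    congr 2
    simp
    ring
  rw [hpos, hneg]
  have h1 : (1 + 2 * π * ξ * Complex.I : ℂ) ≠ 0 := fun h => by
    simpa using congrArg Complex.re h
  have h2 : (1 - 2 * π * ξ * Complex.I : ℂ) ≠ 0 := fun h => by
    simpa using congrArg Complex.re h
  have h3 : (1 + 4 * π ^ 2 * ξ ^ 2 : ℂ)
      = (1 + 2 * π * ξ * Complex.I) * (1 - 2 * π * ξ * Complex.I) := by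
    linear_combination (4 * π ^ 2 * ξ ^ 2 : ℂ) * Complex.I_sq
  push_cast
  rw [h3]
  field_simp
  ring

/-- The adjoint embedding `E₂^* : L²(ℝ) → H²(ℝ)` acts as convolution with
`G₄(x) = (1/4)e^{-|x|}(|x|+1)`: for a Schwartz function `u`,
`𝓕⁻¹((1+4π²ξ²)⁻² 𝓕u)(x) = (1/4)∫ e^{-|x-y|}(|x-y|+1) u(y) dy`. -/
theorem adjoint_embedding_E2_filter (u : SchwartzMap ℝ ℂ) :
    ∀ x : ℝ,
      𝓕⁻ (fun ξ : ℝ => ((((1 + 4 * π ^ 2 * ξ ^ 2) ^ 2)⁻¹ : ℝ) : ℂ) * 𝓕 (⇑u) ξ) x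
        = (1 / 4 : ℂ) * ∫ y : ℝ, ((Real.exp (-|x - y|) * (|x - y| + 1) : ℝ) : ℂ) * u y := by
  intro x
  let G : ℝ → ℂ := fun x => (1 / 4 : ℂ) * ((Real.exp (-|x|) * (|x| + 1) : ℝ) : ℂ)
  let L := ContinuousLinearMap.mul ℂ ℂ
  have hG : Integrable G := integrable_exp_neg_abs_mul_abs_add_one.const_mul _
  have hFG (ξ : ℝ) : 𝓕 G ξ = ((((1 + 4 * π ^ 2 * ξ ^ 2) ^ 2)⁻¹ : ℝ) : ℂ) := by
    have : 𝓕 G ξ = (1 / 4 : ℂ) * 𝓕 (fun x : ℝ => ((Real.exp (-|x|) * (|x| + 1) : ℝ) : ℂ)) ξ := by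
      simp only [G, Real.fourier_eq, Circle.smul_def, smul_eq_mul, ← integral_const_mul]
      congr with y
      ring
    rw [this, fourier_exp_neg_abs_mul_abs_add_one]
    ring
  have hF : 𝓕 (convolution G u L volume)
      = fun ξ : ℝ => ((((1 + 4 * π ^ 2 * ξ ^ 2) ^ 2)⁻¹ : ℝ) : ℂ) * 𝓕 (⇑u) ξ := by
    ext ξ
    rw [Real.fourier_mul_convolution_eq hG u.integrable, hFG]
  have hbdd : BddAbove (Set.range fun y => ‖u y‖) := by
    refine ⟨SchwartzMap.seminorm ℂ 0 0 u, ?_⟩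
    rintro _ ⟨y, rfl⟩
    exact u.norm_le_seminorm ℂ y
  have hcont : Continuous (convolution G u L volume) :=
    hbdd.continuous_convolution_right_of_integrable L hG u.continuous
  have hintF : Integrable (𝓕 (convolution G u L volume)) := by
    rw [hF]
    have hu : Integrable (𝓕 (⇑u)) := by
      rw [← SchwartzMap.fourier_coe]
      exact (𝓕 u).integrable
    refine hu.bdd_mul (c := 1) ?_ (.of_forall fun ξ => ?_)
    · exact Measurable.aestronglyMeasurable (by fun_prop)
    · rw [Complex.norm_real, Real.norm_of_nonneg (by positivity)]
      exact inv_le_one_of_one_le₀ (one_le_pow₀ (by nlinarith [sq_nonneg (π * ξ)]))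
  rw [← hF, hcont.fourierInv_fourier_eq (hG.integrable_convolution L u.integrable) hintF,
    convolution_eq_swap, ← integral_const_mul]
  simp only [L, G, ContinuousLinearMap.mul_apply', mul_assoc]
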